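/- Let n ≥ 1 and let λ be a B-partition of n. Then π(λ) ⊆ μ(λ) ⊆ d(λ), where d(λ) = ((λ^t)^−)_C; in particular both π(λ) and μ(λ) are subpartitions of d(λ). -/

import Mathlib

namespace WFPaper

/-- The list of parts of a partition (multiset of positive integers) in weakly
decreasing order. -/
def sortedDesc (s : Multiset ℕ) : List ℕ := (s.sort (· ≤ ·)).reverse

/-- The `j`-th largest part of `s` (1-indexed); `0` if `j = 0` or `j > #s`. -/
def part (s : Multiset ℕ) (j : ℕ) : ℕ := (sortedDesc s).getD (j - 1) 0

/-- The smallest part of `s` (`0` if `s` is empty). -/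
def minPart (s : Multiset ℕ) : ℕ := (s.sort (· ≤ ·)).getD 0 0

/-- Sum of the `j` largest parts of `s`. -/
def psum (s : Multiset ℕ) (j : ℕ) : ℕ := ((sortedDesc s).take j).sum

/-- Dominance order: `DomLE a b` means `a ≤ b` in the dominance order, i.e.
for every `j` the sum of the `j` largest parts of `a` is at most that of `b`. -/
def DomLE (a b : Multiset ℕ) : Prop := ∀ j, psum a j ≤ psum b j

/-- All parts are positive. -/
def PosParts (s : Multiset ℕ) : Prop := ∀ x ∈ s, 0 < x

/-- A partition of an odd number in which every even part has even multiplicity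
(a B-partition of `n` when the sum is `2*n+1`). -/
def IsTypeB (s : Multiset ℕ) : Prop :=
  PosParts s ∧ Odd s.sum ∧ ∀ x, Even x → Even (s.count x)

/-- A partition of an even number in which every odd part has even multiplicity
(a C-partition of `n` when the sum is `2*n`). -/
def IsTypeC (s : Multiset ℕ) : Prop :=
  PosParts s ∧ Even s.sum ∧ ∀ x, Odd x → Even (s.count x)

/-- A partition of an even number in which every even part has even multiplicity
(a D-partition of `n` when the sum is `2*n`). -/
def IsTypeD (s : Multiset ℕ) : Prop :=
  PosParts s ∧ Even s.sum ∧ ∀ x, Even x → Even (s.count x)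

/-- `IsCollapse T α β` : `β` is the dominance-largest partition of class `T` of
the same number as `α` which is dominated by `α` (e.g. the B/C/D-collapse of `α`
for `T = IsTypeB/IsTypeC/IsTypeD`). -/
def IsCollapse (T : Multiset ℕ → Prop) (α β : Multiset ℕ) : Prop :=
  T β ∧ β.sum = α.sum ∧ DomLE β α ∧
    ∀ γ, T γ → γ.sum = α.sum → DomLE γ α → DomLE γ β

/-- The transpose (conjugate) partition: its `j`-th part (0-indexed `j`) is the
number of parts of `s` that are `≥ j+1`. -/
def transpose (s : Multiset ℕ) : Multiset ℕ :=
  (Multiset.range (part s 1)).map (fun j => (s.filter (fun x => j + 1 ≤ x)).card)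

/-- `λ⁻` : subtract 1 from the smallest part (the part being deleted if it
becomes 0). -/
def decMin (s : Multiset ℕ) : Multiset ℕ :=
  ((minPart s - 1) ::ₘ s.erase (minPart s)).filter (fun x => 0 < x)

/-- `λ⁺` : add 1 to the largest part. -/
def incMax (s : Multiset ℕ) : Multiset ℕ :=
  (part s 1 + 1) ::ₘ s.erase (part s 1)

/-- The subpartition `μ` of `T` whose multiplicity at an even `x` is 2 if
`m_T(x)` is even and nonzero, 1 if `m_T(x)` is odd, and 0 at odd `x`. -/
def muEven (T : Multiset ℕ) : Multiset ℕ :=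
  (T.toFinset.filter (fun x => Even x)).val.bind
    (fun x => Multiset.replicate (if Even (T.count x) then 2 else 1) x)

/-- The subpartition `μ` of `T` whose multiplicity at an odd `x` is 2 if
`m_T(x)` is even and nonzero, 1 if `m_T(x)` is odd, and 0 at even `x`. -/
def muOdd (T : Multiset ℕ) : Multiset ℕ :=
  (T.toFinset.filter (fun x => Odd x)).val.bind
    (fun x => Multiset.replicate (if Even (T.count x) then 2 else 1) x)

/-- The subpartition `π` of `T` consisting of the even parts of `T` of odd
multiplicity, each taken once. -/
def piEven (T : Multiset ℕ) : Multiset ℕ :=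
  (T.toFinset.filter (fun x => Even x ∧ Odd (T.count x))).val

/-- `k` is a (1-indexed) position of an odd part of `s`. -/
def OddIdx (s : Multiset ℕ) (k : ℕ) : Prop := 1 ≤ k ∧ Odd (part s k)

/-- `k` is a (1-indexed) position of an even part of `s`. -/
def EvenIdx (s : Multiset ℕ) (k : ℕ) : Prop :=
  1 ≤ k ∧ k ≤ Multiset.card s ∧ Even (part s k)

/-- `e_s(i,j)` : number of positions `i ≤ k ≤ j` with `s_k` even. -/
def eCount (s : Multiset ℕ) (i j : ℕ) : ℕ :=
  ((Finset.Icc i j).filter (fun k => Even (part s k))).card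

/-- number of positions `i ≤ k ≤ j` with `s_k` odd. -/
def oCount (s : Multiset ℕ) (i j : ℕ) : ℕ :=
  ((Finset.Icc i j).filter (fun k => Odd (part s k))).card

/-- `s` is special in the e-count sense: `e_s(1,t₁)` is even, and
`e_s(tᵢ,tᵢ₊₁)` is even for all `1 ≤ i ≤ p-1`, where `t₁ < ⋯ < t_p` are the
positions of the odd parts of `s`. -/
def IsSpecialE (s : Multiset ℕ) : Prop :=
  (∀ t, OddIdx s t → (∀ t', OddIdx s t' → t ≤ t') → Even (eCount s 1 t)) ∧
  (∀ i j, OddIdx s i → OddIdx s j → i < j →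
    (∀ k, OddIdx s k → k ≤ i ∨ j ≤ k) → Even (eCount s i j))

/-- `s` is quasi-special: `e_s(1,t₁)` is even, `e_s(tᵢ,tᵢ₊₁)` is even for all
`1 ≤ i ≤ p-2`, and the smallest part of `s` is odd with multiplicity 1. -/
def IsQuasiSpecialE (s : Multiset ℕ) : Prop :=
  (∀ t, OddIdx s t → (∀ t', OddIdx s t' → t ≤ t') → Even (eCount s 1 t)) ∧
  (∀ i j, OddIdx s i → OddIdx s j → i < j →
    (∀ k, OddIdx s k → k ≤ i ∨ j ≤ k) → (∃ k, OddIdx s k ∧ j < k) →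
      Even (eCount s i j)) ∧
  Odd (minPart s) ∧ s.count (minPart s) = 1

/-- Number of odd parts greater than every even part (equals the number of odd
parts greater than the largest even part, and the number of all odd parts if
there are no even parts). -/
def numOddDominant (s : Multiset ℕ) : ℕ :=
  (s.filter (fun x => Odd x ∧ ∀ y ∈ s, Even y → y < x)).card

/-- Between every pair of consecutive even parts of `s` (in the decreasing
listing of the parts) there is an even number of odd parts. -/
def EvenBetween (s : Multiset ℕ) : Prop :=
  ∀ i j, EvenIdx s i → EvenIdx s j → i < j →
    (∀ k, EvenIdx s k → k ≤ i ∨ j ≤ k) → Even (oCount s i j)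

/-- A special B-partition. -/
def IsSpecialTypeB (s : Multiset ℕ) : Prop :=
  IsTypeB s ∧ EvenBetween s ∧ Odd (numOddDominant s)

/-- A special D-partition. -/
def IsSpecialTypeD (s : Multiset ℕ) : Prop :=
  IsTypeD s ∧ EvenBetween s ∧ Even (numOddDominant s)

/-- The parts of `s` in weakly decreasing order, as a sequence indexed from `0`. -/
def row (s : Multiset ℕ) (i : ℕ) : ℕ := (sortedDesc s).getD i 0

theorem coe_sortedDesc (s : Multiset ℕ) : (sortedDesc s : Multiset ℕ) = s := by
  simp [sortedDesc]

theorem length_sortedDesc (s : Multiset ℕ) : (sortedDesc s).length = s.card := by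
  simp [sortedDesc]

theorem pairwise_sortedDesc (s : Multiset ℕ) : (sortedDesc s).Pairwise (· ≥ ·) := by
  unfold sortedDesc
  rw [List.pairwise_reverse]
  exact s.pairwise_sort (· ≤ ·)

theorem row_eq_zero {s : Multiset ℕ} {i : ℕ} (h : s.card ≤ i) : row s i = 0 :=
  List.getD_eq_default _ _ (by rwa [length_sortedDesc])

theorem lt_card_of_row_pos {s : Multiset ℕ} {i : ℕ} (h : 0 < row s i) : i < s.card := by
  by_contra! hi
  simp [row_eq_zero hi] at h

theorem map_row (s : Multiset ℕ) : (Multiset.range s.card).map (row s) = s := by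
  conv_rhs => rw [← coe_sortedDesc s]
  rw [← Multiset.coe_range, Multiset.map_coe]
  congr 1
  apply List.ext_getElem
  · simp [length_sortedDesc]
  · intro i h1 h2
    simp [row, h2]

theorem row_antitone (s : Multiset ℕ) : Antitone (row s) := by
  intro i j hij
  by_cases hj : j < (sortedDesc s).length
  · rcases hij.eq_or_lt with rfl | h
    · rfl
    · have := List.pairwise_iff_getElem.1 (pairwise_sortedDesc s) i j (h.trans hj) hj h
      simpa [row, hj, h.trans hj] using this
  · simp [row_eq_zero (by rw [← length_sortedDesc]; omega : s.card ≤ j)]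

theorem row_mem {s : Multiset ℕ} {i : ℕ} (h : i < s.card) : row s i ∈ s := by
  have := Multiset.mem_map_of_mem (row s) (Multiset.mem_range.2 h)
  rwa [map_row] at this

theorem psum_eq (s : Multiset ℕ) (j : ℕ) : psum s j = ∑ i ∈ Finset.range j, row s i := by
  induction j with
  | zero => simp [psum]
  | succ j ih =>
    rw [Finset.sum_range_succ, ← ih]
    unfold psum row
    by_cases hj : j < (sortedDesc s).length
    · rw [List.sum_take_succ _ _ hj]
      simp [hj]
    · push Not at hj
      rw [List.getD_eq_default _ _ hj, List.take_of_length_le hj,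
        List.take_of_length_le (by omega), add_zero]

theorem psum_succ (s : Multiset ℕ) (j : ℕ) : psum s (j + 1) = psum s j + row s j := by
  simp [psum_eq, Finset.sum_range_succ]

theorem psum_of_card_le {s : Multiset ℕ} {j : ℕ} (h : s.card ≤ j) : psum s j = s.sum := by
  unfold psum
  rw [List.take_of_length_le (by rwa [length_sortedDesc]), ← Multiset.sum_coe, coe_sortedDesc]

theorem sortedDesc_map_range {f : ℕ → ℕ} (hf : Antitone f) (L : ℕ) :
    sortedDesc ((Multiset.range L).map f) = (List.range L).map f := by
  apply List.Perm.eq_of_pairwise' (r := (· ≥ ·)) (pairwise_sortedDesc _)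
  · rw [List.pairwise_map]
    exact (List.pairwise_lt_range (n := L)).imp fun h => hf h.le
  · rw [← Multiset.coe_eq_coe, coe_sortedDesc]
    rfl

theorem row_map_range {f : ℕ → ℕ} (hf : Antitone f) {L : ℕ} (hL : ∀ i, L ≤ i → f i = 0) (i : ℕ) :
    row ((Multiset.range L).map f) i = f i := by
  unfold row
  rw [sortedDesc_map_range hf]
  by_cases h : i < L
  · simp [h]
  · rw [List.getD_eq_default _ _ (by simpa using h), hL i (by omega)]

theorem row_filter_map_range {f : ℕ → ℕ} (hf : Antitone f) {L : ℕ} (hL : ∀ i, L ≤ i → f i = 0)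
    (i : ℕ) : row (((Multiset.range L).map f).filter (fun x => 0 < x)) i = f i := by
  induction L with
  | zero => simpa using row_map_range hf hL i
  | succ L ih =>
    by_cases h : f L = 0
    · rw [Multiset.range_succ, Multiset.map_cons, Multiset.filter_cons_of_neg _ (by simp [h])]
      exact ih fun j hj => Nat.le_zero.1 (h ▸ hf hj)
    · rw [Multiset.filter_eq_self.2]
      · exact row_map_range hf hL i
      · intro x hx
        obtain ⟨j, hj, rfl⟩ := Multiset.mem_map.1 hx
        exact (Nat.pos_of_ne_zero h).trans_le (hf (Nat.lt_succ_iff.1 (Multiset.mem_range.1 hj)))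

theorem count_eq_card (s : Multiset ℕ) (x : ℕ) :
    s.count x = ((Finset.range s.card).filter (fun i => row s i = x)).card := by
  conv_lhs => rw [← map_row s]
  rw [Multiset.count_map]
  simp only [Finset.card, Finset.filter_val, Finset.range_val, eq_comm]

theorem even_sum_filter {s : Multiset ℕ} (hs : IsTypeC s) (c : ℕ) :
    Even (s.filter (fun x => c < x)).sum := by
  rw [Finset.sum_multiset_count]
  refine Finset.even_sum _ fun x hx => ?_
  rw [smul_eq_mul, Multiset.count_filter_of_pos (Multiset.mem_filter.1 (by simpa using hx)).2]
  rcases Nat.even_or_odd x with h | h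
  · exact h.mul_left _
  · exact (hs.2.2 x h).mul_right _

/-- In a C-partition a prefix of odd sum ends in the middle of a run of equal odd parts. -/
theorem IsTypeC.row_of_odd_psum {s : Multiset ℕ} (hs : IsTypeC s) {j : ℕ}
    (hj : Odd (psum s (j + 1))) : row s j = row s (j + 1) ∧ Odd (row s j) := by
  have hsum : psum s (j + 1) = (s.filter (fun x => row s (j + 1) < x)).sum +
      ((Finset.range (j + 1)).filter (fun i => ¬ row s (j + 1) < row s i)).card *
        row s (j + 1) := by
    rw [psum_eq, ← Finset.sum_filter_add_sum_filter_not _ (fun i => row s (j + 1) < row s i)]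
    congr 1
    · generalize hc : row s (j + 1) = c
      conv_rhs => rw [← map_row s]
      rw [Multiset.filter_map]
      subst hc
      change _ = ∑ i ∈ (Finset.range s.card).filter (fun i => row s (j + 1) < row s i), row s i
      refine Finset.sum_congr ?_ fun _ _ => rfl
      ext i
      simp only [Finset.mem_filter, Finset.mem_range, and_congr_left_iff]
      intro hi
      have h1 := lt_card_of_row_pos (s := s) (i := i) (by omega)
      have h2 : i < j + 1 := by
        by_contra! h
        have := row_antitone s h
        omega
      simp [h1, h2]
    · rw [← smul_eq_mul, ← Finset.sum_const]
      refine Finset.sum_congr rfl fun i hi => ?_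
      simp only [Finset.mem_filter, Finset.mem_range, not_lt] at hi
      exact le_antisymm hi.2 (row_antitone s hi.1.le)
  rw [hsum, Nat.odd_add] at hj
  have hev := even_sum_filter hs (row s (j + 1))
  have hodd := Nat.not_even_iff_odd.1 fun h => Nat.not_odd_iff_even.2 hev (hj.2 h)
  obtain ⟨hc, hr⟩ := Nat.odd_mul.1 hodd
  obtain ⟨i, hi⟩ := Finset.card_pos.1 hc.pos
  simp only [Finset.mem_filter, Finset.mem_range, not_lt] at hi
  have heq : row s j = row s (j + 1) :=
    le_antisymm ((row_antitone s (by omega)).trans hi.2) (row_antitone s (by omega))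
  exact ⟨heq, heq ▸ hr⟩

theorem exists_threshold (s : Multiset ℕ) (x : ℕ) : ∃ m, ∀ i, i < m ↔ x < row s i := by
  have hex : ∃ m, row s m ≤ x := ⟨s.card, by simp [row_eq_zero le_rfl]⟩
  refine ⟨Nat.find hex, fun i => ⟨fun h => not_le.1 (Nat.find_min hex h), fun h => ?_⟩⟩
  by_contra! hi
  have := row_antitone s hi
  have := Nat.find_spec hex
  omega

theorem isTypeC_of_row {s : Multiset ℕ} (hpos : PosParts s)
    (h : ∀ j, Odd (psum s (j + 1)) → row s j = row s (j + 1) ∧ Odd (row s j)) : IsTypeC s := by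
  have key : ∀ x m, (∀ i, i < m ↔ x < row s i) → Even (psum s m) := by
    intro x m hm
    rcases m with _ | m
    · simp [psum]
    · by_contra hodd
      have h1 := (h m (Nat.not_even_iff_odd.1 hodd)).1
      have h2 := (hm m).1 (by omega)
      have h3 := (hm (m + 1)).2 (by omega)
      omega
  refine ⟨hpos, ?_, ?_⟩
  · rw [← psum_of_card_le (le_refl s.card)]
    refine key 0 _ fun i => ⟨fun hi => hpos _ (row_mem hi), lt_card_of_row_pos⟩
  · intro x hx
    obtain ⟨y, rfl⟩ : ∃ y, x = y + 1 := ⟨x - 1, by have := hx.pos; omega⟩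
    obtain ⟨m, hm⟩ := exists_threshold s (y + 1)
    obtain ⟨m', hm'⟩ := exists_threshold s y
    have hmm : m ≤ m' := by
      by_contra! hlt
      have h1 := (hm m').1 hlt
      have h2 := (hm' m').2 (by omega)
      omega
    have hfil : (Finset.range s.card).filter (fun i => row s i = y + 1) = Finset.Ico m m' := by
      ext i
      simp only [Finset.mem_filter, Finset.mem_range, Finset.mem_Ico]
      have h1 := hm i
      have h2 := hm' i
      have h3 := lt_card_of_row_pos (s := s) (i := i)
      omega
    rw [count_eq_card, hfil, Nat.card_Ico]
    have hsum : psum s m' = psum s m + (m' - m) * (y + 1) := by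
      rw [psum_eq, psum_eq, ← Finset.sum_range_add_sum_Ico _ hmm, ← hfil,
        Finset.sum_congr rfl fun i hi => (Finset.mem_filter.1 hi).2, hfil]
      simp
    have h1 := key _ _ hm
    have h2 := key _ _ hm'
    rw [hsum, Nat.even_add] at h2
    have h3 := h2.1 h1
    rw [Nat.even_mul] at h3
    exact h3.resolve_right (Nat.not_even_iff_odd.2 hx)

/-- The amount by which the C-collapse lowers the sum of the `j` largest parts of `s`. -/
def defect (s : Multiset ℕ) (j : ℕ) : ℕ :=
  if Odd (psum s j) ∧ ¬ (row s (j - 1) = row s j ∧ Odd (row s j)) then 1 else 0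

theorem defect_le_one (s : Multiset ℕ) (j : ℕ) : defect s j ≤ 1 := by
  unfold defect
  split_ifs <;> simp

theorem defect_zero (s : Multiset ℕ) : defect s 0 = 0 := by
  simp [defect, psum]

theorem defect_succ_eq_one_iff (s : Multiset ℕ) (j : ℕ) :
    defect s (j + 1) = 1 ↔
      (psum s j + row s j) % 2 = 1 ∧ ¬ (row s j = row s (j + 1) ∧ row s (j + 1) % 2 = 1) := by
  simp [defect, psum_succ, Nat.odd_iff]

theorem defect_eq_one_of_even_row {s : Multiset ℕ} {j : ℕ} (h : Odd (psum s j))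
    (hr : Even (row s j)) : defect s j = 1 := by
  unfold defect
  rw [if_pos ⟨h, fun h' => Nat.not_even_iff_odd.2 h'.2 hr⟩]

theorem defect_succ_eq_one_of_even_row {s : Multiset ℕ} {j : ℕ} (h : Odd (psum s (j + 1)))
    (hr : Even (row s j)) : defect s (j + 1) = 1 := by
  unfold defect
  rw [if_pos ⟨h, fun h' => Nat.not_even_iff_odd.2 h'.2 (h'.1 ▸ hr)⟩]

theorem defect_succ_le (s : Multiset ℕ) (j : ℕ) : defect s (j + 1) ≤ row s j + defect s j := by
  by_contra! hlt
  have h1 := defect_le_one s (j + 1)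
  have h2 := (defect_succ_eq_one_iff s j).1 (by omega)
  have h3 : row s j = 0 := by omega
  have := defect_eq_one_of_even_row (s := s) (j := j) (Nat.odd_iff.2 (by omega)) (by simp [h3])
  omega

/-- The parts of the C-collapse of `s` (or of `decMin s`, if the sum of `s` is odd). -/
def collapseRow (s : Multiset ℕ) (j : ℕ) : ℕ := row s j + defect s j - defect s (j + 1)

theorem collapseRow_antitone (s : Multiset ℕ) : Antitone (collapseRow s) := by
  refine antitone_nat_of_succ_le fun j => ?_
  unfold collapseRow
  have h0 := defect_succ_le s j
  have h1 := defect_succ_le s (j + 1)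
  have h2 := row_antitone s (Nat.le_add_right j 1)
  have h3 := defect_le_one s (j + 1)
  have h4 := defect_succ_eq_one_iff s j
  have h5 := defect_succ_eq_one_iff s (j + 1)
  have h6 := psum_succ s j
  by_cases hb : defect s (j + 1) = 1
  · obtain ⟨ho, hne⟩ := h4.1 hb
    have hleft : row s j % 2 = 0 → defect s j = 1 := fun he =>
      defect_eq_one_of_even_row (Nat.odd_iff.2 (by omega)) (Nat.even_iff.2 he)
    have hright : row s (j + 1) % 2 = 0 → defect s (j + 1 + 1) = 1 := fun he =>
      defect_succ_eq_one_of_even_row (Nat.odd_iff.2 (by rw [psum_succ]; omega)) (Nat.even_iff.2 he)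
    omega
  · omega

theorem sum_collapseRow (s : Multiset ℕ) (j : ℕ) :
    ∑ i ∈ Finset.range j, collapseRow s i + defect s j = psum s j := by
  induction j with
  | zero => simp [defect_zero, psum]
  | succ j ih =>
    rw [Finset.sum_range_succ, psum_succ, ← ih, collapseRow]
    have := defect_succ_le s j
    omega

/-- A partition whose parts are given by `collapseRow`. -/
def collapse (s : Multiset ℕ) : Multiset ℕ :=
  ((Multiset.range s.card).map (collapseRow s)).filter (fun x => 0 < x)

theorem defect_of_card_le {s : Multiset ℕ} (hs : Odd s.sum) {j : ℕ} (h : s.card ≤ j) :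
    defect s j = 1 :=
  defect_eq_one_of_even_row (by rwa [psum_of_card_le h]) (by simp [row_eq_zero h])

theorem row_collapse {s : Multiset ℕ} (hs : Odd s.sum) (i : ℕ) :
    row (collapse s) i = collapseRow s i := by
  refine row_filter_map_range (collapseRow_antitone s) (fun i hi => ?_) i
  simp [collapseRow, defect_of_card_le hs hi, defect_of_card_le hs (hi.trans (Nat.le_succ i)),
    row_eq_zero hi]

theorem psum_collapse {s : Multiset ℕ} (hs : Odd s.sum) (j : ℕ) :
    psum (collapse s) j + defect s j = psum s j := by
  rw [psum_eq, Finset.sum_congr rfl fun i _ => row_collapse hs i, sum_collapseRow]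

theorem isTypeC_collapse {s : Multiset ℕ} (hs : Odd s.sum) : IsTypeC (collapse s) := by
  refine isTypeC_of_row (fun x hx => (Multiset.mem_filter.1 hx).2) fun j hj => ?_
  rw [row_collapse hs, row_collapse hs]
  have h0 := psum_collapse hs (j + 1)
  have h1 := defect_le_one s (j + 1)
  have h2 := psum_succ s j
  have h3 := defect_succ_eq_one_iff s j
  have h4 := defect_succ_eq_one_iff s (j + 1)
  have h5 := psum_succ s (j + 1)
  have h6 := defect_le_one s (j + 1 + 1)
  have h7 : Even (psum s j) → defect s j = 0 := fun he =>
    if_neg fun h => Nat.not_even_iff_odd.2 h.1 he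
  rw [Nat.even_iff] at h7
  rw [Nat.odd_iff] at hj ⊢
  unfold collapseRow
  by_cases hb : defect s (j + 1) = 1
  · have := h3.1 hb
    omega
  · have hb0 : defect s (j + 1) = 0 := by omega
    have : row s j = row s (j + 1) ∧ row s (j + 1) % 2 = 1 := by
      by_contra hne
      exact hb (h3.2 ⟨by omega, hne⟩)
    have h8 := h7 (by omega)
    omega

/-- A C-partition below `s` stays below `s` lowered by its defects. -/
theorem IsTypeC.psum_add_defect_le {s γ : Multiset ℕ} (hγ : IsTypeC γ) (h : DomLE γ s) (j : ℕ) :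
    psum γ j + defect s j ≤ psum s j := by
  by_contra! hlt
  have h0 := h j
  have h1 := defect_le_one s j
  rcases j with _ | j
  · simp [psum, defect_zero] at hlt
  have h2 := (defect_succ_eq_one_iff s j).1 (by omega)
  have h3 := psum_succ s j
  obtain ⟨h4, h5⟩ := hγ.row_of_odd_psum (j := j) (Nat.odd_iff.2 (by omega))
  have h6 := psum_succ γ j
  have h7 := psum_succ s (j + 1)
  have h8 := psum_succ γ (j + 1)
  have h9 := h j
  have h10 := h (j + 1 + 1)
  have h11 := row_antitone s (Nat.le_add_right j 1)
  rw [Nat.odd_iff] at h5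
  omega

theorem minPart_eq {s : Multiset ℕ} (h : s ≠ 0) : minPart s = row s (s.card - 1) := by
  have hc := Multiset.card_pos.2 h
  unfold minPart row sortedDesc
  rw [List.getD_eq_getElem _ _ (by simpa using hc), List.getD_eq_getElem _ _ (by simpa using hc),
    List.getElem_reverse]
  congr 1
  simp

theorem row_decMin {s : Multiset ℕ} (h : s ≠ 0) (i : ℕ) :
    row (decMin s) i = if i = s.card - 1 then row s i - 1 else row s i := by
  obtain ⟨L, hL⟩ : ∃ L, s.card = L + 1 := ⟨s.card - 1, by have := Multiset.card_pos.2 h; omega⟩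
  set f : ℕ → ℕ := fun i => if i = s.card - 1 then row s i - 1 else row s i with hf
  have hdec : decMin s = ((Multiset.range s.card).map f).filter (fun x => 0 < x) := by
    unfold decMin
    congr 1
    have hs := map_row s
    rw [hL, Multiset.range_succ, Multiset.map_cons] at hs
    rw [minPart_eq h, hL, Multiset.range_succ, Multiset.map_cons]
    congr 1
    · simp [hf, hL]
    · rw [show L + 1 - 1 = L from rfl]
      generalize hc : row s L = c at hs ⊢
      rw [← hs, Multiset.erase_cons_head]
      refine Multiset.map_congr rfl fun i hi => ?_
      have := Multiset.mem_range.1 hi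
      simp only [hf, hL]
      rw [if_neg (by omega)]
  rw [hdec]
  refine row_filter_map_range (antitone_nat_of_succ_le fun j => ?_) (fun i hi => ?_) i
  · have h1 := row_antitone s (Nat.le_add_right j 1)
    have h2 : s.card ≤ j + 1 → row s (j + 1) = 0 := row_eq_zero
    simp only [hf]
    split_ifs <;> omega
  · simp [hf, row_eq_zero hi]

theorem psum_decMin {s : Multiset ℕ} (h : s ≠ 0) (hpos : PosParts s) (j : ℕ) :
    psum (decMin s) j + (if s.card ≤ j then 1 else 0) = psum s j := by
  have hc := Multiset.card_pos.2 h
  induction j with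
  | zero => simp [psum, h]
  | succ j ih =>
    have h1 : j < s.card → 0 < row s j := fun hj => hpos _ (row_mem hj)
    rw [psum_succ, psum_succ, ← ih, row_decMin h]
    split_ifs <;> omega

theorem sum_decMin {s : Multiset ℕ} (h : s ≠ 0) (hpos : PosParts s) :
    (decMin s).sum + 1 = s.sum := by
  have h1 := psum_decMin h hpos (s.card + (decMin s).card)
  rwa [psum_of_card_le (Nat.le_add_left _ _), psum_of_card_le (Nat.le_add_right _ _),
    if_pos (Nat.le_add_right _ _)] at h1

theorem sum_collapse {s : Multiset ℕ} (hs : Odd s.sum) : (collapse s).sum + 1 = s.sum := by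
  have h1 := psum_collapse hs (s.card + (collapse s).card)
  rwa [psum_of_card_le (Nat.le_add_left _ _), psum_of_card_le (Nat.le_add_right _ _),
    defect_of_card_le hs (Nat.le_add_right _ _)] at h1

theorem psum_collapse_decMin {s d : Multiset ℕ} (hs : Odd s.sum) (hpos : PosParts s)
    (hd : IsCollapse IsTypeC (decMin s) d) (j : ℕ) : psum d j + defect s j = psum s j := by
  obtain ⟨hC, -, hle, hmax⟩ := hd
  have h0 : s ≠ 0 := by
    rintro rfl
    simp at hs
  refine le_antisymm (hC.psum_add_defect_le (fun k => ?_) j) ?_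
  · have := psum_decMin h0 hpos k
    exact (hle k).trans (by omega)
  · have hsum : (collapse s).sum = (decMin s).sum := by
      have := sum_decMin h0 hpos
      have := sum_collapse hs
      omega
    have := hmax _ (isTypeC_collapse hs) hsum (fun k => ?_) j
    · have := psum_collapse hs j
      omega
    · have h1 := psum_collapse hs k
      have h2 := psum_decMin h0 hpos k
      split_ifs at h2 with hk
      · have := defect_of_card_le hs hk
        omega
      · omega

theorem row_transpose (l : Multiset ℕ) (i : ℕ) :
    row (transpose l) i = (l.filter (fun x => i + 1 ≤ x)).card := by
  refine row_map_range (f := fun i => (l.filter (fun x => i + 1 ≤ x)).card) (fun i j hij => ?_)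
    (fun i hi => ?_) i
  · exact Multiset.card_le_card (Multiset.monotone_filter_right l fun x hx => by omega)
  · rw [Multiset.card_eq_zero, Multiset.filter_eq_nil]
    intro x hx hlt
    rw [← map_row l] at hx
    obtain ⟨k, -, rfl⟩ := Multiset.mem_map.1 hx
    have h1 := row_antitone l (Nat.zero_le k)
    change row l 0 ≤ i at hi
    omega

theorem posParts_transpose (l : Multiset ℕ) : PosParts (transpose l) := by
  intro x hx
  obtain ⟨j, hj, rfl⟩ := Multiset.mem_map.1 hx
  have hj' : j < row l 0 := Multiset.mem_range.1 hj
  exact Multiset.card_pos_iff_exists_mem.2 ⟨row l 0, Multiset.mem_filter.2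
    ⟨row_mem (lt_card_of_row_pos (by omega)), hj'⟩⟩

theorem row_transpose_eq_add_count (l : Multiset ℕ) (i : ℕ) :
    row (transpose l) i = row (transpose l) (i + 1) + l.count (i + 1) := by
  rw [row_transpose, row_transpose, Multiset.count, Multiset.countP_eq_card_filter,
    ← Multiset.card_add]
  congr 1
  ext x
  simp only [Multiset.count_add, Multiset.count_filter]
  split_ifs <;> omega

theorem IsTypeB.odd_card {l : Multiset ℕ} (hl : IsTypeB l) : Odd l.card := by
  have h : Even (l.sum + l.card) := by
    rw [Finset.sum_multiset_count, ← Multiset.toFinset_sum_count_eq, ← Finset.sum_add_distrib]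
    refine Finset.even_sum _ fun x _ => ?_
    rw [smul_eq_mul, ← mul_add_one]
    rcases Nat.even_or_odd x with hx | hx
    · exact (hl.2.2 x hx).mul_right _
    · exact hx.add_one.mul_left _
  rw [Nat.even_add] at h
  exact Nat.not_even_iff_odd.1 fun hc => Nat.not_even_iff_odd.2 hl.2.1 (h.2 hc)

theorem IsTypeB.odd_psum_transpose {l : Multiset ℕ} (hl : IsTypeB l) (k : ℕ) :
    Odd (psum (transpose l) (2 * k + 1)) := by
  induction k with
  | zero =>
    rw [psum_succ, row_transpose, Multiset.filter_eq_self.2 fun x hx => by have := hl.1 x hx; omega]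
    simpa [psum] using hl.odd_card
  | succ k ih =>
    rw [show 2 * (k + 1) + 1 = 2 * k + 2 + 1 by ring, psum_succ, psum_succ]
    have h0 : row (transpose l) (2 * k + 1) = row (transpose l) (2 * k + 2) +
        l.count (2 * k + 2) := row_transpose_eq_add_count l (2 * k + 1)
    have h1 := hl.2.2 (2 * k + 2) ⟨k + 1, by ring⟩
    rw [Nat.even_iff] at h1
    rw [Nat.odd_iff] at ih ⊢
    omega

theorem IsTypeB.odd_sum_transpose {l : Multiset ℕ} (hl : IsTypeB l) :
    Odd (transpose l).sum := by
  have := hl.odd_psum_transpose (transpose l).card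
  rwa [psum_of_card_le (by omega)] at this

theorem IsTypeB.odd_psum_of_even_row {l : Multiset ℕ} (hl : IsTypeB l) {j : ℕ}
    (hj : Even (row (transpose l) j)) :
    Odd (psum (transpose l) j) ∧ Odd (psum (transpose l) (j + 1)) := by
  have h := psum_succ (transpose l) j
  rw [Nat.even_iff] at hj
  rw [Nat.odd_iff, Nat.odd_iff]
  rcases Nat.even_or_odd' j with ⟨k, rfl | rfl⟩
  · have := Nat.odd_iff.1 (hl.odd_psum_transpose k)
    omega
  · have := Nat.odd_iff.1 (hl.odd_psum_transpose k)
    omega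

/-- The even parts of the transpose of a B-partition survive in the C-collapse. -/
theorem IsTypeB.row_collapse_eq {l d : Multiset ℕ} (hl : IsTypeB l)
    (hd : IsCollapse IsTypeC (decMin (transpose l)) d) {j : ℕ}
    (hj : Even (row (transpose l) j)) : row d j = row (transpose l) j := by
  obtain ⟨h1, h2⟩ := hl.odd_psum_of_even_row hj
  have h3 := psum_collapse_decMin hl.odd_sum_transpose (posParts_transpose l) hd j
  have h4 := psum_collapse_decMin hl.odd_sum_transpose (posParts_transpose l) hd (j + 1)
  rw [defect_eq_one_of_even_row h1 hj] at h3
  rw [defect_succ_eq_one_of_even_row h2 hj, psum_succ, psum_succ] at h4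
  omega

theorem IsTypeB.count_transpose_le {l d : Multiset ℕ} (hl : IsTypeB l)
    (hd : IsCollapse IsTypeC (decMin (transpose l)) d) {x : ℕ} (hx : Even x) :
    (transpose l).count x ≤ d.count x := by
  rw [count_eq_card, count_eq_card]
  refine Finset.card_le_card fun i hi => ?_
  obtain ⟨h1, rfl⟩ := Finset.mem_filter.1 hi
  have h2 := hl.row_collapse_eq hd hx
  refine Finset.mem_filter.2 ⟨Finset.mem_range.2 (lt_card_of_row_pos ?_), h2⟩
  rw [h2]
  exact posParts_transpose l _ (row_mem (Finset.mem_range.1 h1))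

theorem count_muEven (T : Multiset ℕ) (x : ℕ) :
    (muEven T).count x =
      if x ∈ T ∧ Even x then (if Even (T.count x) then 2 else 1) else 0 := by
  unfold muEven
  rw [Multiset.count_bind]
  simp only [Multiset.count_replicate]
  change ∑ b ∈ T.toFinset.filter (fun x => Even x),
    (if b = x then (if Even (T.count b) then 2 else 1) else 0) = _
  rw [Finset.sum_ite_eq']
  simp

theorem count_piEven (T : Multiset ℕ) (x : ℕ) :
    (piEven T).count x = if x ∈ T ∧ Even x ∧ Odd (T.count x) then 1 else 0 := by
  unfold piEven
  rw [Multiset.count_eq_of_nodup (Finset.nodup _)]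
  simp

theorem piEven_le_muEven (T : Multiset ℕ) : piEven T ≤ muEven T := by
  refine Multiset.le_iff_count.2 fun x => ?_
  rw [count_piEven, count_muEven]
  split_ifs <;> first | omega | tauto

theorem muEven_le_filter (T : Multiset ℕ) : muEven T ≤ T.filter (fun x => Even x) := by
  refine Multiset.le_iff_count.2 fun x => ?_
  rw [count_muEven, Multiset.count_filter]
  split_ifs with h1 h2 h3
  · obtain ⟨k, hk⟩ := h2
    have := Multiset.count_pos.2 h1.1
    omega
  · tauto
  · exact Multiset.count_pos.2 h1.1
  · tauto
  · simp
  · simp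

/-- For a B-partition `λ` of `n ≥ 1`, one has
`π(λ) ⊆ μ(λ) ⊆ d(λ)` where `d(λ) = ((λᵗ)⁻)_C`. -/
theorem statement3 (n : ℕ) (hn : 1 ≤ n) (l : Multiset ℕ)
    (hB : IsTypeB l ∧ l.sum = 2 * n + 1)
    (d : Multiset ℕ) (hd : IsCollapse IsTypeC (decMin (transpose l)) d) :
    piEven (transpose l) ≤ muEven (transpose l) ∧ muEven (transpose l) ≤ d := by
  refine ⟨piEven_le_muEven _, (muEven_le_filter _).trans (Multiset.le_iff_count.2 fun x => ?_)⟩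
  rw [Multiset.count_filter]
  split_ifs with hx
  · exact hB.1.count_transpose_le hd hx
  · exact Nat.zero_le _

end WFPaper
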